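/- Let ⟨O,λ_X⟩ be a satisfiable Why[X]-annotated ELHI⊥ ontology and suppose O^{Why[X]} ⊨ (α,κ) for some κ ∈ Why[X], where α is one of: an assertion; a BCQ; an RI P ⊑ Q with P a role satisfiable w.r.t. O; or a GCI C ⊑ D with C an ELHI concept satisfiable w.r.t. O. Then κ is a monomial over X, i.e., κ = {m} for some finite m ⊆ X. -/

import Mathlib

namespace DLProv

/-! ### Syntax of ELHI⊥ -/

/-- A role: a role name or an inverse role. Role names are natural numbers. -/
inductive DLRole : Type
  | name : ℕ → DLRole
  | inv : ℕ → DLRole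
deriving DecidableEq

/-- The underlying role name of a role. -/
def DLRole.base : DLRole → ℕ
  | .name R => R
  | .inv R => R

/-- The inverse of a role. -/
def DLRole.invr : DLRole → DLRole
  | .name R => .inv R
  | .inv R => .name R

/-- ELHI⊥ concepts (built from concept names, ⊤, ⊥, ⊓ and ∃P.C). -/
inductive DLConcept : Type
  | top : DLConcept
  | bot : DLConcept
  | atom : ℕ → DLConcept
  | inter : DLConcept → DLConcept → DLConcept
  | exis : DLRole → DLConcept → DLConcept
deriving DecidableEq

namespace DLConcept

/-- ELHI concepts: those not mentioning ⊥. -/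
def botFree : DLConcept → Prop
  | top => True
  | bot => False
  | atom _ => True
  | inter C D => C.botFree ∧ D.botFree
  | exis _ C => C.botFree

/-- Basic concepts: concept names and concepts of the form ∃P (= ∃P.⊤). -/
def isBasic (C : DLConcept) : Prop := (∃ A, C = atom A) ∨ ∃ P, C = exis P top

/-- Admissible right-hand sides of GCIs: ⊥, a concept name, or ∃P. -/
def isRHS (C : DLConcept) : Prop := C = bot ∨ (∃ A, C = atom A) ∨ ∃ P, C = exis P top

/-- A concept name or ⊤. -/
def isAtomic (C : DLConcept) : Prop := C = top ∨ ∃ A, C = atom A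

/-- Concept names occurring in a concept. -/
def concNames : DLConcept → Finset ℕ
  | top => ∅
  | bot => ∅
  | atom A => {A}
  | inter C D => C.concNames ∪ D.concNames
  | exis _ C => C.concNames

/-- Role names occurring in a concept. -/
def roleNames : DLConcept → Finset ℕ
  | top => ∅
  | bot => ∅
  | atom _ => ∅
  | inter C D => C.roleNames ∪ D.roleNames
  | exis P C => insert P.base C.roleNames

end DLConcept

/-- ELHI⊥ axioms: concept assertions A(a), role assertions R(a,b),
role inclusions P ⊑ Q, negative role inclusions P ⊓ Q ⊑ ⊥, and GCIs C ⊑ D. -/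
inductive DLAxiom : Type
  | cassert : ℕ → ℕ → DLAxiom
  | rassert : ℕ → ℕ → ℕ → DLAxiom
  | roleInc : DLRole → DLRole → DLAxiom
  | roleDisj : DLRole → DLRole → DLAxiom
  | gci : DLConcept → DLConcept → DLAxiom
deriving DecidableEq

namespace DLAxiom

/-- Well-formedness: the right-hand side of a GCI is ⊥, a concept name, or ∃P. -/
def wf : DLAxiom → Prop
  | gci _ D => D.isRHS
  | _ => True

def isAssertion : DLAxiom → Prop
  | cassert _ _ => True
  | rassert _ _ _ => True
  | _ => False

def concNames : DLAxiom → Finset ℕ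
  | cassert A _ => {A}
  | rassert _ _ _ => ∅
  | roleInc _ _ => ∅
  | roleDisj _ _ => ∅
  | gci C D => C.concNames ∪ D.concNames

def roleNames : DLAxiom → Finset ℕ
  | cassert _ _ => ∅
  | rassert R _ _ => {R}
  | roleInc P Q => {P.base, Q.base}
  | roleDisj P Q => {P.base, Q.base}
  | gci C D => C.roleNames ∪ D.roleNames

def indNames : DLAxiom → Finset ℕ
  | cassert _ a => {a}
  | rassert _ a b => {a, b}
  | _ => ∅

/-- ⊥ does not occur in the axiom. -/
def botFree : DLAxiom → Prop
  | cassert _ _ => True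
  | rassert _ _ _ => True
  | roleInc _ _ => True
  | roleDisj _ _ => False
  | gci C D => C.botFree ∧ D.botFree

/-- Normal form: every GCI is of one of the forms A₁ ⊓ A₂ ⊑ B, ∃P.A ⊑ B, or A ⊑ ∃P,
with A, A₁, A₂ ∈ N_C ∪ {⊤} and B ∈ N_C ∪ {⊥}. -/
def inNF : DLAxiom → Prop
  | gci C D =>
      (∃ C₁ C₂, C = .inter C₁ C₂ ∧ C₁.isAtomic ∧ C₂.isAtomic ∧ (D = .bot ∨ ∃ B, D = .atom B)) ∨
      (∃ P C', C = .exis P C' ∧ C'.isAtomic ∧ (D = .bot ∨ ∃ B, D = .atom B)) ∨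
      (C.isAtomic ∧ ∃ P, D = .exis P .top)
  | _ => True

end DLAxiom

/-! ### Annotated interpretations over a commutative semiring -/

/-- A 𝕂-annotated interpretation with domain `dom` inside the type `Δ`. -/
structure Interp (Δ : Type) (K : Type) where
  dom : Set Δ
  dom_nonempty : dom.Nonempty
  indiv : ℕ → Δ
  indiv_mem : ∀ a, indiv a ∈ dom
  conc : ℕ → Set (Δ × K)
  conc_mem : ∀ A p, p ∈ conc A → p.1 ∈ dom
  role : ℕ → Set (Δ × Δ × K)
  role_mem : ∀ R p, p ∈ role R → p.1 ∈ dom ∧ p.2.1 ∈ dom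

variable {Δ Δ' K : Type}

/-- Annotated extension of a role. -/
def DLRole.interp (I : Interp Δ K) : DLRole → Set (Δ × Δ × K)
  | .name R => I.role R
  | .inv R => {p | (p.2.1, p.1, p.2.2) ∈ I.role R}

/-- Annotated extension of a concept. -/
def DLConcept.interp [CommSemiring K] (I : Interp Δ K) : DLConcept → Set (Δ × K)
  | .top => {p | p.1 ∈ I.dom ∧ p.2 = 1}
  | .bot => ∅
  | .atom A => I.conc A
  | .inter C D => {p | ∃ d κ₁ κ₂, (d, κ₁) ∈ DLConcept.interp I C ∧
      (d, κ₂) ∈ DLConcept.interp I D ∧ p = (d, κ₁ * κ₂)}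
  | .exis P C => {p | ∃ d e κ₁ κ₂, (d, e, κ₁) ∈ DLRole.interp I P ∧
      (e, κ₂) ∈ DLConcept.interp I C ∧ p = (d, κ₁ * κ₂)}

/-- Satisfaction of an annotated axiom. -/
def Interp.satA [CommSemiring K] (I : Interp Δ K) : DLAxiom → K → Prop
  | .cassert A a, κ => (I.indiv a, κ) ∈ I.conc A
  | .rassert R a b, κ => (I.indiv a, I.indiv b, κ) ∈ I.role R
  | .roleInc P Q, κ => ∀ d e κ', (d, e, κ') ∈ P.interp I → (d, e, κ * κ') ∈ Q.interp I
  | .roleDisj P Q, _ => ∀ d e κ₁ κ₂, (d, e, κ₁) ∈ P.interp I → (d, e, κ₂) ∈ Q.interp I → False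
  | .gci C .bot, _ => C.interp I = ∅
  | .gci C D, κ => ∀ d κ', (d, κ') ∈ C.interp I → (d, κ * κ') ∈ D.interp I

/-! ### Conjunctive queries -/

inductive DLTerm : Type
  | var : ℕ → DLTerm
  | ind : ℕ → DLTerm
deriving DecidableEq

/-- Query atoms: A(t) with A ∈ N_C ∪ {⊤}, or R(t,t') with R ∈ N_R. -/
inductive QAtom : Type
  | top : DLTerm → QAtom
  | conc : ℕ → DLTerm → QAtom
  | role : ℕ → DLTerm → DLTerm → QAtom
deriving DecidableEq

/-- A (Boolean) conjunctive query: a conjunction of atoms, all variables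
existentially quantified. -/
abbrev BCQ := List QAtom

def Interp.tval (I : Interp Δ K) (π : ℕ → Δ) : DLTerm → Δ
  | .var v => π v
  | .ind a => I.indiv a

/-- A match of the extended version of an atom, assigning value `κ` to its
annotation variable. -/
def QAtom.holds [CommSemiring K] (I : Interp Δ K) (π : ℕ → Δ) : QAtom → K → Prop
  | .top t, κ => I.tval π t ∈ I.dom ∧ κ = 1
  | .conc A t, κ => (I.tval π t, κ) ∈ I.conc A
  | .role R t t', κ => (I.tval π t, I.tval π t', κ) ∈ I.role R

/-- `I` satisfies the annotated BCQ (q, κ): some match of the extended version of `q`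
gives κ as the product of the values of the annotation variables. -/
def Interp.satQ [CommSemiring K] (I : Interp Δ K) (q : BCQ) (κ : K) : Prop :=
  ∃ π : ℕ → Δ, (∀ v, π v ∈ I.dom) ∧
    ∃ κs : List K, List.Forall₂ (fun a k => QAtom.holds I π a k) q κs ∧ κs.prod = κ

/-- A statement: an axiom or a BCQ. -/
inductive DLStmt : Type
  | ax : DLAxiom → DLStmt
  | query : BCQ → DLStmt

def Interp.satS [CommSemiring K] (I : Interp Δ K) : DLStmt → K → Prop
  | .ax α, κ => I.satA α κ
  | .query q, κ => I.satQ q κ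

/-! ### Annotated ontologies, models and entailment -/

/-- The set of annotated axioms of the annotated ontology ⟨O, λ⟩. -/
def toAnn (O : Finset DLAxiom) (lam : DLAxiom → K) : Set (DLAxiom × K) :=
  {p | p.1 ∈ O ∧ p.2 = lam p.1}

def isModel [CommSemiring K] (I : Interp Δ K) (Ω : Set (DLAxiom × K)) : Prop :=
  ∀ p ∈ Ω, I.satA p.1 p.2

/-- Satisfiability of a set of annotated axioms. -/
def AnnSat [CommSemiring K] (Ω : Set (DLAxiom × K)) : Prop :=
  ∃ (Δ : Type) (I : Interp Δ K), isModel I Ω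

/-- Entailment of an annotated statement from a set of annotated axioms. -/
def Entails [CommSemiring K] (Ω : Set (DLAxiom × K)) (s : DLStmt) (κ : K) : Prop :=
  ∀ (Δ : Type) (I : Interp Δ K), isModel I Ω → I.satS s κ

/-! ### Non-annotated (plain) semantics -/

structure PInterp (Δ : Type) where
  dom : Set Δ
  dom_nonempty : dom.Nonempty
  indiv : ℕ → Δ
  indiv_mem : ∀ a, indiv a ∈ dom
  conc : ℕ → Set Δ
  conc_mem : ∀ A d, d ∈ conc A → d ∈ dom
  role : ℕ → Set (Δ × Δ)
  role_mem : ∀ R p, p ∈ role R → p.1 ∈ dom ∧ p.2 ∈ dom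

def DLRole.pinterp (I : PInterp Δ) : DLRole → Set (Δ × Δ)
  | .name R => I.role R
  | .inv R => {p | (p.2, p.1) ∈ I.role R}

def DLConcept.pinterp (I : PInterp Δ) : DLConcept → Set Δ
  | .top => I.dom
  | .bot => ∅
  | .atom A => I.conc A
  | .inter C D => DLConcept.pinterp I C ∩ DLConcept.pinterp I D
  | .exis P C => {d | ∃ e, (d, e) ∈ DLRole.pinterp I P ∧ e ∈ DLConcept.pinterp I C}

def PInterp.satA (I : PInterp Δ) : DLAxiom → Prop
  | .cassert A a => I.indiv a ∈ I.conc A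
  | .rassert R a b => (I.indiv a, I.indiv b) ∈ I.role R
  | .roleInc P Q => ∀ p ∈ P.pinterp I, p ∈ Q.pinterp I
  | .roleDisj P Q => ∀ p, p ∈ P.pinterp I → p ∈ Q.pinterp I → False
  | .gci C D => C.pinterp I ⊆ D.pinterp I

def PInterp.tval (I : PInterp Δ) (π : ℕ → Δ) : DLTerm → Δ
  | .var v => π v
  | .ind a => I.indiv a

def QAtom.pholds (I : PInterp Δ) (π : ℕ → Δ) : QAtom → Prop
  | .top t => I.tval π t ∈ I.dom
  | .conc A t => I.tval π t ∈ I.conc A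
  | .role R t t' => (I.tval π t, I.tval π t') ∈ I.role R

def PInterp.satQ (I : PInterp Δ) (q : BCQ) : Prop :=
  ∃ π : ℕ → Δ, (∀ v, π v ∈ I.dom) ∧ ∀ a ∈ q, QAtom.pholds I π a

def PInterp.satS (I : PInterp Δ) : DLStmt → Prop
  | .ax α => I.satA α
  | .query q => I.satQ q

def isPModel (I : PInterp Δ) (O : Finset DLAxiom) : Prop := ∀ α ∈ O, I.satA α

def PSat (O : Finset DLAxiom) : Prop := ∃ (Δ : Type) (I : PInterp Δ), isPModel I O

def PEntails (O : Finset DLAxiom) (s : DLStmt) : Prop :=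
  ∀ (Δ : Type) (I : PInterp Δ), isPModel I O → I.satS s

/-- A concept is satisfiable w.r.t. O if it has a nonempty extension in some model of O. -/
def CSat (O : Finset DLAxiom) (C : DLConcept) : Prop :=
  ∃ (Δ : Type) (I : PInterp Δ), isPModel I O ∧ (C.pinterp I).Nonempty

/-- A role is satisfiable w.r.t. O if it has a nonempty extension in some model of O. -/
def RSat (O : Finset DLAxiom) (P : DLRole) : Prop :=
  ∃ (Δ : Type) (I : PInterp Δ), isPModel I O ∧ (P.pinterp I).Nonempty

/-- The plain interpretation obtained from an annotated one by dropping annotations. -/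
def Interp.forget (I : Interp Δ K) : PInterp Δ where
  dom := I.dom
  dom_nonempty := I.dom_nonempty
  indiv := I.indiv
  indiv_mem := I.indiv_mem
  conc A := {d | ∃ κ, (d, κ) ∈ I.conc A}
  conc_mem := fun A d hd => by obtain ⟨κ, hκ⟩ := hd; exact I.conc_mem A _ hκ
  role R := {p | ∃ κ, (p.1, p.2, κ) ∈ I.role R}
  role_mem := fun R p hp => by obtain ⟨κ, hκ⟩ := hp; exact I.role_mem R _ hκ

/-! ### ω-continuous commutative semirings and provenance -/

/-- The canonical preorder of a semiring: a ≤ b iff a ⊕ c = b for some c. -/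
def canLE [Add K] (a b : K) : Prop := ∃ c, a + c = b

/-- The set of all sums of finite subsets of `S`. -/
def finSubsums [AddCommMonoid K] (S : Set K) : Set K :=
  {x | ∃ F : Finset K, ↑F ⊆ S ∧ F.sum id = x}

/-- `u` is a least upper bound of `S` w.r.t. the canonical preorder. -/
def IsSupOf [Add K] (S : Set K) (u : K) : Prop :=
  (∀ a ∈ S, canLE a u) ∧ ∀ v, (∀ a ∈ S, canLE a v) → canLE u v

/-- ω-continuous commutative semirings: the canonical preorder is a partial order,
ω-chains have least upper bounds preserved by ⊕ and ⊗, and possibly infinite sums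
are defined as suprema of finite subsums. -/
class OmegaCS (K : Type) extends CommSemiring K where
  canLE_antisymm : ∀ a b : K, canLE a b → canLE b a → a = b
  csup : (ℕ → K) → K
  csup_isSup : ∀ f : ℕ → K, (∀ n, canLE (f n) (f (n + 1))) → IsSupOf (Set.range f) (csup f)
  add_csup : ∀ f : ℕ → K, (∀ n, canLE (f n) (f (n + 1))) →
      ∀ a : K, a + csup f = csup fun n => a + f n
  mul_csup : ∀ f : ℕ → K, (∀ n, canLE (f n) (f (n + 1))) →
      ∀ a : K, a * csup f = csup fun n => a * f n
  setSum : Set K → K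
  setSum_isSup : ∀ S : Set K, IsSupOf (finSubsums S) (setSum S)

/-- The provenance of a statement w.r.t. a set of annotated axioms: the (possibly
infinite) sum of all κ such that (s, κ) is entailed. -/
def prov [OmegaCS K] (Ω : Set (DLAxiom × K)) (s : DLStmt) : K :=
  OmegaCS.setSum {κ | Entails Ω s κ}

/-! ### Instance queries -/

/-- `qCt C t n` is the (body of) the instance query for the concept `C` with head
term `t`, using fresh variables starting from `n`; returns the query together with
the next fresh variable index. -/
def qCt : DLConcept → DLTerm → ℕ → BCQ × ℕ
  | .top, t, n => ([QAtom.top t], n)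
  | .bot, t, n => ([QAtom.top t], n)
  | .atom A, t, n => ([QAtom.conc A t], n)
  | .inter C D, t, n =>
      let r₁ := qCt C t n
      let r₂ := qCt D t r₁.2
      (r₁.1 ++ r₂.1, r₂.2)
  | .exis (.name R) C, t, n =>
      let r := qCt C (.var n) (n + 1)
      (QAtom.role R t (.var n) :: r.1, r.2)
  | .exis (.inv R) C, t, n =>
      let r := qCt C (.var n) (n + 1)
      (QAtom.role R (.var n) t :: r.1, r.2)

/-- The instance query q_C(a) for an individual name a. -/
def qCa (C : DLConcept) (a : ℕ) : BCQ := (qCt C (DLTerm.ind a) 0).1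

/-! ### Database matches -/

def tvalN (σ : ℕ → ℕ) : DLTerm → ℕ
  | .var v => σ v
  | .ind a => a

def QAtom.dbHolds (O : Finset DLAxiom) (σ : ℕ → ℕ) : QAtom → Prop
  | .top _ => True
  | .conc A t => DLAxiom.cassert A (tvalN σ t) ∈ O
  | .role R t t' => DLAxiom.rassert R (tvalN σ t) (tvalN σ t') ∈ O

/-- A database match of a BCQ in a set of assertions. -/
def isDBMatch (O : Finset DLAxiom) (σ : ℕ → ℕ) (q : BCQ) : Prop :=
  ∀ a ∈ q, QAtom.dbHolds O σ a

def QAtom.dbVal [CommSemiring K] (lam : DLAxiom → K) (σ : ℕ → ℕ) : QAtom → K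
  | .top _ => 1
  | .conc A t => lam (DLAxiom.cassert A (tvalN σ t))
  | .role R t t' => lam (DLAxiom.rassert R (tvalN σ t) (tvalN σ t'))

/-- The ⊗-product, over the atoms of `q`, of the annotations of the matched facts. -/
def matchVal [CommSemiring K] (lam : DLAxiom → K) (σ : ℕ → ℕ) (q : BCQ) : K :=
  (q.map (QAtom.dbVal lam σ)).prod

/-! ### Homomorphisms and canonical models -/

/-- Homomorphism between 𝕂-annotated interpretations. -/
def IsHom [CommSemiring K] (Ic : Interp Δ K) (I : Interp Δ' K) (g : Δ → Δ') : Prop :=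
  Set.MapsTo g Ic.dom I.dom ∧ (∀ a, g (Ic.indiv a) = I.indiv a) ∧
  (∀ A d κ, (d, κ) ∈ Ic.conc A → (g d, κ) ∈ I.conc A) ∧
  (∀ R d e κ, (d, e, κ) ∈ Ic.role R → (g d, g e, κ) ∈ I.role R)

/-- Domain of canonical models: individual names (inl) plus fresh elements (inr). -/
abbrev CD : Type := ℕ ⊕ ℕ

def baseConc (Ω : Set (DLAxiom × K)) (A : ℕ) : Set (CD × K) :=
  {p | ∃ a κ, (DLAxiom.cassert A a, κ) ∈ Ω ∧ p = (Sum.inl a, κ)}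

def baseRole (Ω : Set (DLAxiom × K)) (R : ℕ) : Set (CD × CD × K) :=
  {p | ∃ a b κ, (DLAxiom.rassert R a b, κ) ∈ Ω ∧ p = (Sum.inl a, Sum.inl b, κ)}

/-- The initial interpretation I₀ of the canonical model construction. -/
def InitCan (Ω : Set (DLAxiom × K)) (I : Interp CD K) : Prop :=
  I.dom = Set.range (Sum.inl : ℕ → CD) ∧ I.indiv = Sum.inl ∧
  (∀ A, I.conc A = baseConc Ω A) ∧ (∀ R, I.role R = baseRole Ω R)

/-- Where and how a tuple is inserted for the role `P`: the underlying role name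
and the (suitably oriented) tuple. -/
def insRole (P : DLRole) (d e : CD) (κ : K) : ℕ × (CD × CD × K) :=
  match P with
  | .name R => (R, (d, e, κ))
  | .inv R => (R, (e, d, κ))

/-- One application of a rule of the canonical model construction. -/
def StepCan [CommSemiring K] (Ω : Set (DLAxiom × K)) (I J : Interp CD K) : Prop :=
  (∃ P Q κ d e κ', (DLAxiom.roleInc P Q, κ) ∈ Ω ∧ (d, e, κ') ∈ DLRole.interp I P ∧
     J.dom = I.dom ∧ J.indiv = I.indiv ∧ (∀ A, J.conc A = I.conc A) ∧
     (∀ S, S ≠ (insRole Q d e (κ * κ')).1 → J.role S = I.role S) ∧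
     J.role (insRole Q d e (κ * κ')).1 =
       insert (insRole Q d e (κ * κ')).2 (I.role (insRole Q d e (κ * κ')).1)) ∨
  (∃ C A κ d κ', (DLAxiom.gci C (DLConcept.atom A), κ) ∈ Ω ∧ (d, κ') ∈ DLConcept.interp I C ∧
     J.dom = I.dom ∧ J.indiv = I.indiv ∧ (∀ R, J.role R = I.role R) ∧
     (∀ B, B ≠ A → J.conc B = I.conc B) ∧ J.conc A = insert (d, κ * κ') (I.conc A)) ∨
  (∃ C P κ d κ' df, (DLAxiom.gci C (DLConcept.exis P DLConcept.top), κ) ∈ Ω ∧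
     (d, κ') ∈ DLConcept.interp I C ∧ df ∉ I.dom ∧
     J.dom = insert df I.dom ∧ J.indiv = I.indiv ∧ (∀ A, J.conc A = I.conc A) ∧
     (∀ S, S ≠ (insRole P d df (κ * κ')).1 → J.role S = I.role S) ∧
     J.role (insRole P d df (κ * κ')).1 =
       insert (insRole P d df (κ * κ')).2 (I.role (insRole P d df (κ * κ')).1))

/-- Fairness: every applicable rule instance has eventually been applied,
i.e. the limit is closed under the rules. -/
def ClosedCan [CommSemiring K] (Ω : Set (DLAxiom × K)) (I : Interp CD K) : Prop :=
  (∀ P Q κ, (DLAxiom.roleInc P Q, κ) ∈ Ω →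
      ∀ d e κ', (d, e, κ') ∈ DLRole.interp I P → (d, e, κ * κ') ∈ DLRole.interp I Q) ∧
  (∀ C A κ, (DLAxiom.gci C (DLConcept.atom A), κ) ∈ Ω →
      ∀ d κ', (d, κ') ∈ DLConcept.interp I C → (d, κ * κ') ∈ I.conc A) ∧
  (∀ C P κ, (DLAxiom.gci C (DLConcept.exis P DLConcept.top), κ) ∈ Ω →
      ∀ d κ', (d, κ') ∈ DLConcept.interp I C → ∃ e, (d, e, κ * κ') ∈ DLRole.interp I P)

/-- `I` is the union of the increasing sequence `Iseq`. -/
def IsLimitOf (Iseq : ℕ → Interp CD K) (I : Interp CD K) : Prop :=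
  I.dom = (⋃ n, (Iseq n).dom) ∧ I.indiv = (Iseq 0).indiv ∧
  (∀ A, I.conc A = ⋃ n, (Iseq n).conc A) ∧ (∀ R, I.role R = ⋃ n, (Iseq n).role R)

/-- `I` is a canonical model of the annotated ontology `Ω`. -/
def IsCanMod [CommSemiring K] (Ω : Set (DLAxiom × K)) (I : Interp CD K) : Prop :=
  ∃ Iseq : ℕ → Interp CD K, InitCan Ω (Iseq 0) ∧
    (∀ n, Iseq (n + 1) = Iseq n ∨ StepCan Ω (Iseq n) (Iseq (n + 1))) ∧
    IsLimitOf Iseq I ∧ ClosedCan Ω I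

/-- The initial interpretation of the canonical model construction for a basic
concept `C` annotated with `κ`, with distinguished fresh element `dC`. -/
def InitCanC [CommSemiring K] (Ω : Set (DLAxiom × K)) (C : DLConcept) (κ : K)
    (dC : CD) (I : Interp CD K) : Prop :=
  I.indiv = Sum.inl ∧ dC ∉ Set.range (Sum.inl : ℕ → CD) ∧
  match C with
  | .atom A =>
      I.dom = insert dC (Set.range (Sum.inl : ℕ → CD)) ∧
      (∀ B, B ≠ A → I.conc B = baseConc Ω B) ∧
      I.conc A = insert (dC, κ) (baseConc Ω A) ∧
      (∀ R, I.role R = baseRole Ω R)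
  | .exis P .top =>
      ∃ df, df ∉ Set.range (Sum.inl : ℕ → CD) ∧ df ≠ dC ∧
        I.dom = insert dC (insert df (Set.range (Sum.inl : ℕ → CD))) ∧
        (∀ B, I.conc B = baseConc Ω B) ∧
        (∀ S, S ≠ (insRole P dC df κ).1 → I.role S = baseRole Ω S) ∧
        I.role (insRole P dC df κ).1 =
          insert (insRole P dC df κ).2 (baseRole Ω (insRole P dC df κ).1)
  | _ => False

/-- `I` is a canonical model of the basic concept `C`, annotation `κ` and `Ω`. -/
def IsCanModC [CommSemiring K] (Ω : Set (DLAxiom × K)) (C : DLConcept) (κ : K)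
    (dC : CD) (I : Interp CD K) : Prop :=
  ∃ Iseq : ℕ → Interp CD K, InitCanC Ω C κ dC (Iseq 0) ∧
    (∀ n, Iseq (n + 1) = Iseq n ∨ StepCan Ω (Iseq n) (Iseq (n + 1))) ∧
    IsLimitOf Iseq I ∧ ClosedCan Ω I



/-! ### The Why[X] provenance semiring: sets of monomials (finite sets of variables) -/

section Why
variable {V : Type} [DecidableEq V]

/-- Multiplication of sets of monomials. -/
def wmul (S T : Set (Finset V)) : Set (Finset V) := {m | ∃ s ∈ S, ∃ t ∈ T, m = s ∪ t}

instance whyZero : Zero (Set (Finset V)) := ⟨∅⟩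
instance whyOne : One (Set (Finset V)) := ⟨{∅}⟩
instance whyAdd : Add (Set (Finset V)) := ⟨fun S T => S ∪ T⟩
instance whyMul : Mul (Set (Finset V)) := ⟨wmul⟩

instance whyCS : CommSemiring (Set (Finset V)) where
  add S T := S ∪ T
  add_assoc := Set.union_assoc
  zero := ∅
  zero_add := Set.empty_union
  add_zero := Set.union_empty
  add_comm := Set.union_comm
  mul := wmul
  nsmul := nsmulRec
  npow := npowRec
  mul_assoc a b c := by
    show wmul (wmul a b) c = wmul a (wmul b c)
    ext m
    constructor
    · rintro ⟨s, ⟨x, hx, y, hy, rfl⟩, t, ht, rfl⟩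
      exact ⟨x, hx, y ∪ t, ⟨y, hy, t, ht, rfl⟩, (Finset.union_assoc x y t)⟩
    · rintro ⟨s, hs, t, ⟨x, hx, y, hy, rfl⟩, rfl⟩
      exact ⟨s ∪ x, ⟨s, hs, x, hx, rfl⟩, y, hy, (Finset.union_assoc s x y).symm⟩
  one := {∅}
  one_mul a := by
    show wmul {∅} a = a
    ext m
    constructor
    · rintro ⟨s, hs, t, ht, rfl⟩
      rw [Set.mem_singleton_iff] at hs
      subst hs; simpa using ht
    · intro hm; exact ⟨∅, rfl, m, hm, by simp⟩
  mul_one a := by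
    show wmul a {∅} = a
    ext m
    constructor
    · rintro ⟨s, hs, t, ht, rfl⟩
      rw [Set.mem_singleton_iff] at ht
      subst ht; simpa using hs
    · intro hm; exact ⟨m, hm, ∅, rfl, by simp⟩
  mul_comm a b := by
    show wmul a b = wmul b a
    ext m
    constructor
    · rintro ⟨s, hs, t, ht, rfl⟩; exact ⟨t, ht, s, hs, Finset.union_comm s t⟩
    · rintro ⟨s, hs, t, ht, rfl⟩; exact ⟨t, ht, s, hs, Finset.union_comm s t⟩
  left_distrib a b c := by
    show wmul a (b ∪ c) = wmul a b ∪ wmul a c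
    ext m
    constructor
    · rintro ⟨s, hs, t, ht | ht, rfl⟩
      · exact Or.inl ⟨s, hs, t, ht, rfl⟩
      · exact Or.inr ⟨s, hs, t, ht, rfl⟩
    · rintro (⟨s, hs, t, ht, rfl⟩ | ⟨s, hs, t, ht, rfl⟩)
      · exact ⟨s, hs, t, Or.inl ht, rfl⟩
      · exact ⟨s, hs, t, Or.inr ht, rfl⟩
  right_distrib a b c := by
    show wmul (a ∪ b) c = wmul a c ∪ wmul b c
    ext m
    constructor
    · rintro ⟨s, hs | hs, t, ht, rfl⟩
      · exact Or.inl ⟨s, hs, t, ht, rfl⟩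
      · exact Or.inr ⟨s, hs, t, ht, rfl⟩
    · rintro (⟨s, hs, t, ht, rfl⟩ | ⟨s, hs, t, ht, rfl⟩)
      · exact ⟨s, Or.inl hs, t, ht, rfl⟩
      · exact ⟨s, Or.inr hs, t, ht, rfl⟩
  zero_mul a := by
    show wmul ∅ a = ∅
    ext m; constructor
    · rintro ⟨s, hs, _⟩; exact hs.elim
    · rintro ⟨⟩
  mul_zero a := by
    show wmul a ∅ = ∅
    ext m; constructor
    · rintro ⟨s, hs, t, ht, _⟩; exact ht.elim
    · rintro ⟨⟩

/-- A monomial over `V`, viewed as an element of the Why semiring. -/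
def wmon (m : Finset V) : Set (Finset V) := {m}

/-- The annotation variable of an axiom, as an element of the Why semiring. -/
def wvar (v : V) : Set (Finset V) := {({v} : Finset V)}

lemma why_zero_def : (0 : Set (Finset V)) = ∅ := rfl
lemma why_one_def : (1 : Set (Finset V)) = {∅} := rfl
lemma why_add_def (a b : Set (Finset V)) : a + b = a ∪ b := rfl
lemma why_mul_def (a b : Set (Finset V)) : a * b = wmul a b := rfl

lemma why_canLE_iff (a b : Set (Finset V)) : canLE a b ↔ a ⊆ b := by
  constructor
  · rintro ⟨c, rfl⟩; exact Set.subset_union_left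
  · intro h; exact ⟨b, Set.union_eq_right.mpr h⟩

end Why

lemma wmon_mul_wmon {V : Type} [DecidableEq V] (m n : Finset V) :
    wmon m * wmon n = wmon (m ∪ n) := by
  ext x
  constructor
  · rintro ⟨s, rfl, t, rfl, rfl⟩
    rfl
  · rintro rfl
    exact ⟨m, rfl, n, rfl, rfl⟩

/-- Forgetting annotations commutes with role interpretation. -/
lemma DLRole.mem_pinterp_forget {Δ K : Type} (I : Interp Δ K) (P : DLRole) (d e : Δ) :
    (d, e) ∈ P.pinterp I.forget ↔ ∃ κ, (d, e, κ) ∈ P.interp I := by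
  cases P <;> rfl

/-- Forgetting annotations commutes with concept interpretation. -/
lemma DLConcept.mem_pinterp_forget {Δ K : Type} [CommSemiring K] (I : Interp Δ K)
    (C : DLConcept) (d : Δ) :
    d ∈ C.pinterp I.forget ↔ ∃ κ, (d, κ) ∈ C.interp I := by
  induction C generalizing d with
  | top => exact ⟨fun h => ⟨1, h, rfl⟩, fun ⟨_, h, _⟩ => h⟩
  | bot => exact ⟨fun h => h.elim, fun ⟨_, h⟩ => h.elim⟩
  | atom A => rfl
  | inter C D ihC ihD =>
    constructor
    · rintro ⟨hC, hD⟩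
      obtain ⟨κ₁, h₁⟩ := (ihC d).1 hC
      obtain ⟨κ₂, h₂⟩ := (ihD d).1 hD
      exact ⟨_, d, κ₁, κ₂, h₁, h₂, rfl⟩
    · rintro ⟨κ, d', κ₁, κ₂, h₁, h₂, heq⟩
      obtain ⟨rfl, -⟩ := Prod.mk.inj heq
      exact ⟨(ihC _).2 ⟨_, h₁⟩, (ihD _).2 ⟨_, h₂⟩⟩
  | exis P C ih =>
    constructor
    · rintro ⟨e, hP, hC⟩
      obtain ⟨κ₁, h₁⟩ := (P.mem_pinterp_forget I d e).1 hP
      obtain ⟨κ₂, h₂⟩ := (ih e).1 hC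
      exact ⟨_, d, e, κ₁, κ₂, h₁, h₂, rfl⟩
    · rintro ⟨κ, d', e, κ₁, κ₂, h₁, h₂, heq⟩
      obtain ⟨rfl, -⟩ := Prod.mk.inj heq
      exact ⟨e, (P.mem_pinterp_forget I _ e).2 ⟨_, h₁⟩, (ih _).2 ⟨_, h₂⟩⟩

/-- A plain axiom is satisfied once its annotated version is, whatever the annotation. -/
lemma Interp.forget_satA {Δ K : Type} [CommSemiring K] (I : Interp Δ K) (α : DLAxiom) (κ : K)
    (h : I.satA α κ) : I.forget.satA α := by
  cases α with
  | cassert A a => exact ⟨κ, h⟩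
  | rassert R a b => exact ⟨κ, h⟩
  | roleInc P Q =>
    rintro ⟨d, e⟩ hp
    obtain ⟨κ', h'⟩ := (P.mem_pinterp_forget I d e).1 hp
    exact (Q.mem_pinterp_forget I d e).2 ⟨_, h d e κ' h'⟩
  | roleDisj P Q =>
    rintro ⟨d, e⟩ hp hq
    obtain ⟨κ₁, h₁⟩ := (P.mem_pinterp_forget I d e).1 hp
    obtain ⟨κ₂, h₂⟩ := (Q.mem_pinterp_forget I d e).1 hq
    exact h d e κ₁ κ₂ h₁ h₂
  | gci C D =>
    intro d hd
    obtain ⟨κ', h'⟩ := (C.mem_pinterp_forget I d).1 hd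
    cases D with
    | bot =>
      have hC : C.interp I = ∅ := h
      rw [hC] at h'
      exact h'
    | _ => exact (DLConcept.mem_pinterp_forget I _ d).2 ⟨_, h d κ' h'⟩

/-- Satisfiability of an annotated ontology implies satisfiability of the plain one. -/
lemma AnnSat.pSat {K : Type} [CommSemiring K] {O : Finset DLAxiom} {lam : DLAxiom → K}
    (h : AnnSat (toAnn O lam)) : PSat O := by
  obtain ⟨Δ, I, hI⟩ := h
  exact ⟨Δ, I.forget, fun α hα => I.forget_satA α (lam α) (hI (α, lam α) ⟨hα, rfl⟩)⟩

/-- The Why-annotated interpretation in which every fact of a plain interpretation carries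
every monomial as an annotation. -/
def PInterp.allMon {Δ : Type} (V : Type) (J : PInterp Δ) : Interp Δ (Set (Finset V)) where
  dom := J.dom
  dom_nonempty := J.dom_nonempty
  indiv := J.indiv
  indiv_mem := J.indiv_mem
  conc A := {p | p.1 ∈ J.conc A ∧ ∃ m, p.2 = wmon m}
  conc_mem A p hp := J.conc_mem A p.1 hp.1
  role R := {p | (p.1, p.2.1) ∈ J.role R ∧ ∃ m, p.2.2 = wmon m}
  role_mem R p hp := J.role_mem R (p.1, p.2.1) hp.1

section AllMon
variable {Δ V : Type}

lemma DLRole.mem_interp_allMon (J : PInterp Δ) (P : DLRole) (d e : Δ) (κ : Set (Finset V)) :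
    (d, e, κ) ∈ P.interp (J.allMon V) ↔ (d, e) ∈ P.pinterp J ∧ ∃ m, κ = wmon m := by
  cases P <;> rfl

variable [DecidableEq V]

lemma DLConcept.of_mem_interp_allMon (J : PInterp Δ) (C : DLConcept) (d : Δ)
    (κ : Set (Finset V)) (h : (d, κ) ∈ C.interp (J.allMon V)) :
    d ∈ C.pinterp J ∧ ∃ m, κ = wmon m := by
  induction C generalizing d κ with
  | top => exact ⟨h.1, ∅, h.2⟩
  | bot => exact h.elim
  | atom A => exact h
  | inter C D ihC ihD =>
    obtain ⟨d', κ₁, κ₂, h₁, h₂, heq⟩ := h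
    obtain ⟨rfl, rfl⟩ := Prod.mk.inj heq
    obtain ⟨hC, m, rfl⟩ := ihC _ _ h₁
    obtain ⟨hD, n, rfl⟩ := ihD _ _ h₂
    exact ⟨⟨hC, hD⟩, _, wmon_mul_wmon m n⟩
  | exis P C ih =>
    obtain ⟨d', e, κ₁, κ₂, h₁, h₂, heq⟩ := h
    obtain ⟨rfl, rfl⟩ := Prod.mk.inj heq
    obtain ⟨hP, m, rfl⟩ := (P.mem_interp_allMon J _ _ _).1 h₁
    obtain ⟨hC, n, rfl⟩ := ih _ _ h₂
    exact ⟨⟨e, hP, hC⟩, _, wmon_mul_wmon m n⟩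

lemma DLConcept.one_mem_interp_allMon (J : PInterp Δ) (C : DLConcept) (d : Δ)
    (h : d ∈ C.pinterp J) : (d, (1 : Set (Finset V))) ∈ C.interp (J.allMon V) := by
  induction C generalizing d with
  | top => exact ⟨h, rfl⟩
  | bot => exact h.elim
  | atom A => exact ⟨h, ∅, rfl⟩
  | inter C D ihC ihD => exact ⟨d, 1, 1, ihC d h.1, ihD d h.2, by rw [mul_one]⟩
  | exis P C ih =>
    obtain ⟨e, hP, hC⟩ := h
    exact ⟨d, e, 1, 1, (P.mem_interp_allMon J d e 1).2 ⟨hP, ∅, rfl⟩, ih e hC, by rw [mul_one]⟩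

/-- The all-monomials interpretation of a plain model of a well-formed axiom satisfies that axiom
annotated with any monomial. -/
lemma PInterp.allMon_satA (J : PInterp Δ) (α : DLAxiom) (hwf : α.wf) (v : Finset V)
    (h : J.satA α) : (J.allMon V).satA α (wmon v) := by
  cases α with
  | cassert A a => exact ⟨h, v, rfl⟩
  | rassert R a b => exact ⟨h, v, rfl⟩
  | roleInc P Q =>
    intro d e κ' hP
    obtain ⟨hP', m, rfl⟩ := (P.mem_interp_allMon J d e κ').1 hP
    exact (Q.mem_interp_allMon J d e _).2 ⟨h _ hP', _, wmon_mul_wmon v m⟩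
  | roleDisj P Q =>
    intro d e κ₁ κ₂ h₁ h₂
    exact h (d, e) ((P.mem_interp_allMon J d e κ₁).1 h₁).1 ((Q.mem_interp_allMon J d e κ₂).1 h₂).1
  | gci C D =>
    rcases hwf with rfl | ⟨A, rfl⟩ | ⟨P, rfl⟩
    · refine Set.eq_empty_of_forall_notMem fun p hp => ?_
      exact h (C.of_mem_interp_allMon J p.1 p.2 hp).1
    · intro d κ' hC
      obtain ⟨hC', m, rfl⟩ := C.of_mem_interp_allMon J d κ' hC
      exact ⟨h hC', _, wmon_mul_wmon v m⟩
    · intro d κ' hC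
      obtain ⟨hC', m, rfl⟩ := C.of_mem_interp_allMon J d κ' hC
      obtain ⟨e, hP, he⟩ := h hC'
      exact ⟨d, e, wmon v * wmon m, 1,
        (P.mem_interp_allMon J d e _).2 ⟨hP, _, wmon_mul_wmon v m⟩, ⟨he, rfl⟩, by rw [mul_one]⟩

lemma PInterp.allMon_isModel (J : PInterp Δ) (O : Finset DLAxiom) (hwf : ∀ α ∈ O, α.wf)
    (lam : DLAxiom → V) (hJ : isPModel J O) :
    isModel (J.allMon V) (toAnn O fun α => wvar (lam α)) := by
  rintro ⟨α, κ⟩ ⟨hα, hκ⟩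
  obtain rfl : κ = wmon {lam α} := hκ
  exact J.allMon_satA α (hwf α hα) {lam α} (hJ α hα)

lemma QAtom.holds_allMon (J : PInterp Δ) (π : ℕ → Δ) (a : QAtom) (κ : Set (Finset V))
    (h : a.holds (J.allMon V) π κ) : ∃ m, κ = wmon m := by
  cases a with
  | top t => exact ⟨∅, h.2⟩
  | conc A t => exact h.2
  | role R t t' => exact h.2

lemma PInterp.allMon_satQ (J : PInterp Δ) (q : BCQ) (κ : Set (Finset V))
    (h : (J.allMon V).satQ q κ) : ∃ m, κ = wmon m := by
  obtain ⟨π, -, κs, hκs, rfl⟩ := h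
  induction hκs with
  | nil => exact ⟨∅, rfl⟩
  | cons ha _ ih =>
    obtain ⟨m, rfl⟩ := QAtom.holds_allMon J π _ _ ha
    obtain ⟨n, hn⟩ := ih
    exact ⟨m ∪ n, by rw [List.prod_cons, hn, wmon_mul_wmon]⟩

end AllMon

/-- Over the Why[X] semiring with each axiom annotated with its own
variable, every annotation κ entailed for α (an assertion, a BCQ, an RI with
satisfiable left-hand side, or a GCI whose left-hand side is an ELHI concept
satisfiable w.r.t. O) is a monomial, i.e., a singleton set of monomials. -/
theorem statement14 (O : Finset DLAxiom) (lamX : DLAxiom → ℕ)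
    (hwf : ∀ α ∈ O, α.wf) (hinj : Set.InjOn lamX ↑O)
    (hsat : AnnSat (toAnn O fun α => wvar (lamX α)))
    (s : DLStmt) (κ : Set (Finset ℕ))
    (hform : (∃ α, s = DLStmt.ax α ∧ α.isAssertion) ∨ (∃ q, s = DLStmt.query q) ∨
        (∃ P Q, s = DLStmt.ax (DLAxiom.roleInc P Q) ∧ RSat O P) ∨
        (∃ C D, s = DLStmt.ax (DLAxiom.gci C D) ∧ C.botFree ∧ CSat O C))
    (hent : Entails (toAnn O fun α => wvar (lamX α)) s κ) :
    ∃ m : Finset ℕ, κ = {m} := by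
  rcases hform with ⟨α, rfl, hα⟩ | ⟨q, rfl⟩ | ⟨P, Q, rfl, Δ, J, hJ, ⟨d, e⟩, hP⟩ |
    ⟨C, D, rfl, -, Δ, J, hJ, d, hC⟩
  · obtain ⟨Δ, J, hJ⟩ := hsat.pSat
    have h := hent Δ _ (J.allMon_isModel O hwf lamX hJ)
    cases α with
    | cassert A a => exact h.2
    | rassert R a b => exact h.2
    | _ => exact hα.elim
  · obtain ⟨Δ, J, hJ⟩ := hsat.pSat
    exact J.allMon_satQ q κ (hent Δ _ (J.allMon_isModel O hwf lamX hJ))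
  · have h := hent Δ _ (J.allMon_isModel O hwf lamX hJ) d e 1
      ((P.mem_interp_allMon J d e 1).2 ⟨hP, ∅, rfl⟩)
    rw [mul_one] at h
    exact ((Q.mem_interp_allMon J d e κ).1 h).2
  · have h := hent Δ _ (J.allMon_isModel O hwf lamX hJ)
    have h₁ := C.one_mem_interp_allMon (V := ℕ) J d hC
    cases D with
    | bot =>
      have hbot : C.interp (J.allMon ℕ) = ∅ := h
      rw [hbot] at h₁
      exact h₁.elim
    | _ =>
      have h₂ := h d 1 h₁
      rw [mul_one] at h₂
      exact (DLConcept.of_mem_interp_allMon J _ d κ h₂).2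

end DLProv
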